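/- Let (M, g) be a semi-Riemannian manifold and ξ, η two commuting Killing vector fields whose span is timelike 2-dimensional at each point, acting orthogonally transitively (i.e., the distribution orthogonal to span{ξ,η} is integrable). Then in adapted coordinates (T, Φ, x², x³) with ξ = ∂_T, η = ∂_Φ, the metric takes the block form ds² = G_{ab}(x^M) dy^a dy^b + g_{MN}(x^M) dx^M dx^N with y^a = (T,Φ): there are no cross terms g_{aM} and all components depend only on x², x³. -/

import Mathlib

section LocalGeometry

open Set Filter Topology
open scoped ContDiff

/-- A smooth map on an open set, with invertible derivative at a point, restricts to a local
diffeomorphism near this point. -/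
theorem ContDiffOn.exists_openPartialHomeomorph_contDiffOn_symm
    {E F : Type*} [NormedAddCommGroup E] [NormedSpace ℝ E] [CompleteSpace E]
    [NormedAddCommGroup F] [NormedSpace ℝ F]
    {f : E → F} {U : Set E} (hf : ContDiffOn ℝ ∞ f U) (hU : IsOpen U) {a : E} (ha : a ∈ U)
    {f' : E ≃L[ℝ] F} (hf' : HasFDerivAt f (f' : E →L[ℝ] F) a) :
    ∃ e : OpenPartialHomeomorph E F, ⇑e = f ∧ a ∈ e.source ∧ e.source ⊆ U ∧
      ContDiffOn ℝ ∞ e.symm e.target ∧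
      ∀ x ∈ e.source, fderiv ℝ f x ∈ range ((↑) : (E ≃L[ℝ] F) → E →L[ℝ] F) := by
  have hfa : ContDiffAt ℝ ∞ f a := hf.contDiffAt (hU.mem_nhds ha)
  have hV : IsOpen (U ∩ fderiv ℝ f ⁻¹' range ((↑) : (E ≃L[ℝ] F) → E →L[ℝ] F)) :=
    (hf.continuousOn_fderiv_of_isOpen hU (by simp)).isOpen_inter_preimage hU
      ContinuousLinearEquiv.isOpen
  have haV : a ∈ U ∩ fderiv ℝ f ⁻¹' range ((↑) : (E ≃L[ℝ] F) → E →L[ℝ] F) :=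
    ⟨ha, by rw [mem_preimage, hf'.fderiv]; exact mem_range_self _⟩
  let e := (hfa.toOpenPartialHomeomorph f hf' (by simp)).restrOpen _ hV
  have hsub : e.source ⊆ U ∩ fderiv ℝ f ⁻¹' range ((↑) : (E ≃L[ℝ] F) → E →L[ℝ] F) :=
    fun x hx => hx.2
  refine ⟨e, rfl, ⟨hfa.mem_toOpenPartialHomeomorph_source hf' (by simp), haV⟩,
    fun x hx => (hsub hx).1, fun y hy => ?_, fun x hx => (hsub hx).2⟩
  have hs := hsub (e.map_target hy)
  obtain ⟨f₁, hf₁⟩ := hs.2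
  have hc : ContDiffAt ℝ ∞ f (e.symm y) := hf.contDiffAt (hU.mem_nhds hs.1)
  refine (e.contDiffAt_symm (f₀' := f₁) hy ?_ hc).contDiffWithinAt
  rw [hf₁]
  exact (hc.differentiableAt (by simp)).hasFDerivAt

namespace ContinuousMap

universe u

variable {X : Type*} [TopologicalSpace X] [CompactSpace X]
  {E : Type*} [NormedAddCommGroup E] [NormedSpace ℝ E]

/-- Pointwise application of a continuous family of linear maps to a continuous function. -/
noncomputable def applyL (X : Type*) [TopologicalSpace X] [CompactSpace X]
    (E F : Type*) [NormedAddCommGroup E] [NormedSpace ℝ E]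
    [NormedAddCommGroup F] [NormedSpace ℝ F] :
    C(X, E →L[ℝ] F) →L[ℝ] C(X, E) →L[ℝ] C(X, F) :=
  LinearMap.mkContinuous₂
    (LinearMap.mk₂ ℝ (fun (A : C(X, E →L[ℝ] F)) (u : C(X, E)) =>
        (⟨fun s => A s (u s), by fun_prop⟩ : C(X, F)))
      (fun _ _ _ => by ext; simp) (fun _ _ _ => by ext; simp)
      (fun _ _ _ => by ext; simp) (fun _ _ _ => by ext; simp)) 1 (fun A u => by
        rw [one_mul]
        refine (ContinuousMap.norm_le _ (by positivity)).2 fun s => ?_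
        exact ((A s).le_opNorm _).trans
          (mul_le_mul (A.norm_coe_le_norm s) (u.norm_coe_le_norm s) (norm_nonneg _)
            (norm_nonneg A)))

@[simp] theorem applyL_apply {F : Type*} [NormedAddCommGroup F] [NormedSpace ℝ F]
    (A : C(X, E →L[ℝ] F)) (u : C(X, E)) (s : X) : applyL X E F A u s = A s (u s) := rfl

/-- The superposition operator `u ↦ f ∘ u` of a `C¹` function is differentiable. -/
theorem hasFDerivAt_comp_left {F : Type*} [NormedAddCommGroup F] [NormedSpace ℝ F]
    (f : C(E, F)) (f' : C(E, E →L[ℝ] F)) (hf : ∀ x, HasFDerivAt f (f' x) x) (u : C(X, E)) :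
    HasFDerivAt (fun v : C(X, E) => f.comp v) (applyL X E F (f'.comp u)) u := by
  rw [hasFDerivAt_iff_isLittleO_nhds_zero, Asymptotics.isLittleO_iff]
  intro ε hε
  have hcont : ContinuousAt (fun v : C(X, E) => f'.comp v) u :=
    (f'.continuous_postcomp).continuousAt
  obtain ⟨δ, hδ, hδ'⟩ :=
    (Metric.continuousAt_iff (α := C(X, E)) (β := C(X, E →L[ℝ] F))).1 hcont ε hε
  filter_upwards [Metric.ball_mem_nhds (0 : C(X, E)) hδ] with h hh
  rw [mem_ball_zero_iff] at hh
  refine (ContinuousMap.norm_le _ (by positivity)).2 fun s => ?_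
  have key : ∀ y ∈ segment ℝ (u s) (u s + h s), ‖f' y - f' (u s)‖ ≤ ε := by
    intro y hy
    rw [segment_eq_image'] at hy
    obtain ⟨τ, hτ, rfl⟩ := hy
    have hd : dist (u + τ • h) u < δ := by
      rw [dist_eq_norm, add_sub_cancel_left, norm_smul, Real.norm_of_nonneg hτ.1]
      exact (mul_le_of_le_one_left (norm_nonneg _) hτ.2).trans_lt hh
    have := (f'.comp (u + τ • h) - f'.comp u).norm_coe_le_norm s
    rw [← dist_eq_norm] at this
    simpa using this.trans (hδ' hd).le
  have := (convex_segment (u s) (u s + h s)).norm_image_sub_le_of_norm_hasFDerivWithin_le'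
    (fun y _ => (hf y).hasFDerivWithinAt) key (left_mem_segment ℝ _ _) (right_mem_segment ℝ _ _)
  simp only [add_sub_cancel_left] at this
  refine (le_of_eq ?_).trans (this.trans ?_)
  · simp
  · gcongr
    exact h.norm_coe_le_norm s

/-- The superposition operator `u ↦ f ∘ u` of a smooth function is `Cⁿ`. -/
theorem contDiff_nat_comp_left {E : Type u} [NormedAddCommGroup E] [NormedSpace ℝ E] (n : ℕ) :
    ∀ {F : Type u} [NormedAddCommGroup F] [NormedSpace ℝ F] (f : C(E, F)),
      ContDiff ℝ ∞ f → ContDiff ℝ n (fun v : C(X, E) => f.comp v) := by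
  induction n with
  | zero =>
    intro F _ _ f _
    simpa using f.continuous_postcomp
  | succ n ih =>
    intro F _ _ f hf
    let f' : C(E, E →L[ℝ] F) := ⟨fderiv ℝ f, hf.continuous_fderiv (by simp)⟩
    have hd := hasFDerivAt_comp_left (X := X) f f'
      fun x => (hf.differentiable (by simp) x).hasFDerivAt
    push_cast
    rw [contDiff_succ_iff_hasFDerivAt]
    have h := ih f' (hf.fderiv_right (m := ∞) (by simp))
    have hL : ContDiff ℝ n (applyL X E F) := ContinuousLinearMap.contDiff _
    exact ⟨fun v => applyL X E F (f'.comp v), hL.comp h, hd⟩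

/-- The superposition operator `u ↦ f ∘ u` of a smooth function is smooth. -/
theorem contDiff_comp_left {E F : Type u} [NormedAddCommGroup E] [NormedSpace ℝ E]
    [NormedAddCommGroup F] [NormedSpace ℝ F] (f : C(E, F)) (hf : ContDiff ℝ ∞ f) :
    ContDiff ℝ ∞ (fun v : C(X, E) => f.comp v) :=
  contDiff_infty.2 fun n => contDiff_nat_comp_left n f hf

end ContinuousMap

section Flow

variable {E : Type*} [NormedAddCommGroup E] [NormedSpace ℝ E] [CompleteSpace E]

namespace ContinuousMap

/-- The inclusion of constants into the continuous functions, as a continuous linear map. -/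
noncomputable def constCLM (X E : Type*) [TopologicalSpace X] [CompactSpace X]
    [NormedAddCommGroup E] [NormedSpace ℝ E] : E →L[ℝ] C(X, E) :=
  LinearMap.mkContinuous
    { toFun := ContinuousMap.const X
      map_add' := fun _ _ => rfl
      map_smul' := fun _ _ => rfl } 1 (fun x => by
        rw [one_mul]
        exact (ContinuousMap.norm_le _ (norm_nonneg x)).2 fun _ => le_rfl)

@[simp] theorem constCLM_apply {E : Type*} [NormedAddCommGroup E] [NormedSpace ℝ E] {X : Type*}
    [TopologicalSpace X] [CompactSpace X] (x : E) (s : X) :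
    constCLM X E x s = x := rfl

theorem continuous_extend_projIcc {F : Type*} [TopologicalSpace F] (u : C(Icc (-1 : ℝ) 1, F)) :
    Continuous fun r => u (projIcc (-1) 1 (by norm_num) r) :=
  u.continuous.comp continuous_projIcc

/-- The primitive vanishing at `0` of a continuous function on `[-1, 1]`. -/
noncomputable def primitive (E : Type*) [NormedAddCommGroup E] [NormedSpace ℝ E] :
    C(Icc (-1 : ℝ) 1, E) →L[ℝ] C(Icc (-1 : ℝ) 1, E) :=
  LinearMap.mkContinuous
    { toFun := fun u =>
        ⟨fun s => ∫ r in (0 : ℝ)..s, u (projIcc (-1) 1 (by norm_num) r),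
          (intervalIntegral.continuous_primitive
            (fun a b => u.continuous_extend_projIcc.intervalIntegrable a b) 0).comp
            continuous_subtype_val⟩
      map_add' := fun u v => by
        ext s
        exact intervalIntegral.integral_add (u.continuous_extend_projIcc.intervalIntegrable _ _)
          (v.continuous_extend_projIcc.intervalIntegrable _ _)
      map_smul' := fun c u => by
        ext s
        exact intervalIntegral.integral_smul _ _ } 1 (fun u => by
        rw [one_mul]
        refine (ContinuousMap.norm_le _ (norm_nonneg u)).2 fun s => ?_
        refine (intervalIntegral.norm_integral_le_of_norm_le_const (C := ‖u‖)
          fun r _ => u.norm_coe_le_norm _).trans ?_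
        rw [sub_zero]
        exact mul_le_of_le_one_right (norm_nonneg u) (abs_le.2 s.2))

theorem primitive_apply {E : Type*} [NormedAddCommGroup E] [NormedSpace ℝ E]
    (u : C(Icc (-1 : ℝ) 1, E)) (s : Icc (-1 : ℝ) 1) :
    primitive E u s = ∫ r in (0 : ℝ)..s, u (projIcc (-1) 1 (by norm_num) r) := rfl

/-- Multiplication by an element of `[-1, 1]`, as a self-map of `[-1, 1]`. -/
def mulIcc (s : Icc (-1 : ℝ) 1) : C(Icc (-1 : ℝ) 1, Icc (-1 : ℝ) 1) :=
  ⟨fun r => ⟨s * r, abs_le.1 (by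
    rw [abs_mul]; exact mul_le_one₀ (abs_le.2 s.2) (abs_nonneg _) (abs_le.2 r.2))⟩, by fun_prop⟩

theorem smul_primitive_comp_mulIcc {E : Type*} [NormedAddCommGroup E] [NormedSpace ℝ E]
    (u : C(Icc (-1 : ℝ) 1, E)) (s r : Icc (-1 : ℝ) 1) :
    (s : ℝ) • primitive E (u.comp (mulIcc s)) r = primitive E u (mulIcc s r) := by
  have h1 : (-1 : ℝ) ≤ 1 := by norm_num
  rw [primitive_apply, primitive_apply]
  have : (∫ ρ in (0 : ℝ)..r, u.comp (mulIcc s) (projIcc (-1) 1 h1 ρ)) =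
      ∫ ρ in (0 : ℝ)..r, (fun ρ => u (projIcc (-1) 1 h1 ρ)) (s * ρ) := by
    refine intervalIntegral.integral_congr fun ρ hρ => ?_
    have hρ' : ρ ∈ Icc (-1 : ℝ) 1 := uIcc_subset_Icc (by simp) r.2 hρ
    have hs : (s : ℝ) * ρ ∈ Icc (-1 : ℝ) 1 := (mulIcc s ⟨ρ, hρ'⟩).2
    simp only [ContinuousMap.comp_apply, projIcc_of_mem h1 hρ', projIcc_of_mem h1 hs]
    rfl
  have h2 := intervalIntegral.smul_integral_comp_mul_left (a := 0) (b := (r : ℝ))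
    (fun ρ => u (projIcc (-1) 1 h1 ρ)) (s : ℝ)
  rw [mul_zero] at h2
  rw [this]
  exact h2

end ContinuousMap

open ContinuousMap

/-- A smooth vector field has a smooth local flow. -/
theorem ContDiff.exists_contDiffOn_flow {f : E → E} (hf : ContDiff ℝ ∞ f) (x₀ : E) :
    ∃ (Φ : ℝ × E → E) (ε : ℝ), 0 < ε ∧ ContDiffOn ℝ ∞ Φ (Metric.ball (0, x₀) ε) ∧
      (∀ x ∈ Metric.ball x₀ ε, Φ (0, x) = x) ∧
      ∀ q ∈ Metric.ball ((0 : ℝ), x₀) ε, HasDerivAt (fun t => Φ (t, q.2)) (f (Φ q)) q.1 := by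
  let I := Icc (-1 : ℝ) 1
  let fC : C(E, E) := ⟨f, hf.continuous⟩
  let c₀ : C(I, E) := constCLM I E x₀
  let G : (ℝ × E) × C(I, E) → (ℝ × E) × C(I, E) := fun z =>
    (z.1, z.2 - constCLM I E z.1.2 - z.1.1 • primitive E (fC.comp z.2))
  have hN : ContDiff ℝ ∞ (fun v : C(I, E) => fC.comp v) := contDiff_comp_left fC hf
  have hP : ContDiff ℝ ∞ (fun z : (ℝ × E) × C(I, E) => primitive E (fC.comp z.2)) :=
    (primitive E).contDiff.comp (hN.comp contDiff_snd)
  have hG : ContDiff ℝ ∞ G := by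
    refine contDiff_fst.prodMk ((contDiff_snd.sub ?_).sub (contDiff_fst.fst.smul hP))
    exact (constCLM I E).contDiff.comp contDiff_fst.snd
  let L : ℝ × E →L[ℝ] C(I, E) :=
    (ContinuousLinearMap.fst ℝ ℝ E).smulRight (primitive E (fC.comp c₀)) +
      (constCLM I E).comp (ContinuousLinearMap.snd ℝ ℝ E)
  let G' : ((ℝ × E) × C(I, E)) ≃L[ℝ] (ℝ × E) × C(I, E) :=
    ContinuousLinearEquiv.equivOfInverse
      ((ContinuousLinearMap.fst ℝ (ℝ × E) C(I, E)).prod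
        (ContinuousLinearMap.snd ℝ (ℝ × E) C(I, E) -
          L.comp (ContinuousLinearMap.fst ℝ (ℝ × E) C(I, E))))
      ((ContinuousLinearMap.fst ℝ (ℝ × E) C(I, E)).prod
        (ContinuousLinearMap.snd ℝ (ℝ × E) C(I, E) +
          L.comp (ContinuousLinearMap.fst ℝ (ℝ × E) C(I, E))))
      (fun z => by ext <;> simp) (fun z => by ext <;> simp)
  have hG' : HasFDerivAt G (G' : _ →L[ℝ] _) ((0, x₀), c₀) := by
    have h0 : HasFDerivAt (fun z : (ℝ × E) × C(I, E) => z.1.1)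
        ((ContinuousLinearMap.fst ℝ ℝ E).comp (ContinuousLinearMap.fst ℝ (ℝ × E) C(I, E)))
        ((0, x₀), c₀) :=
      ((ContinuousLinearMap.fst ℝ ℝ E).comp
        (ContinuousLinearMap.fst ℝ (ℝ × E) C(I, E))).hasFDerivAt
    have h1 : HasFDerivAt (fun z : (ℝ × E) × C(I, E) => z.1.1 • primitive E (fC.comp z.2)) _
        ((0, x₀), c₀) := h0.fun_smul (hP.differentiable (by simp) _).hasFDerivAt
    have h2 : HasFDerivAt (fun z : (ℝ × E) × C(I, E) => constCLM I E z.1.2)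
        ((constCLM I E).comp
          ((ContinuousLinearMap.snd ℝ ℝ E).comp (ContinuousLinearMap.fst ℝ (ℝ × E) C(I, E))))
        ((0, x₀), c₀) :=
      ((constCLM I E).comp ((ContinuousLinearMap.snd ℝ ℝ E).comp
        (ContinuousLinearMap.fst ℝ (ℝ × E) C(I, E)))).hasFDerivAt
    refine (hasFDerivAt_fst.prodMk ((hasFDerivAt_snd.sub h2).sub h1)).congr_fderiv ?_
    ext z <;> simp [G', L, c₀]
  obtain ⟨e, heG, hea, -, hes, -⟩ :=
    hG.contDiffOn.exists_openPartialHomeomorph_contDiffOn_symm isOpen_univ (mem_univ _) hG'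
  have hG₀ : G ((0, x₀), c₀) = ((0, x₀), 0) := by simp [G, c₀]
  have he0 : e ((0, x₀), c₀) = ((0, x₀), 0) := by rw [heG, hG₀]
  have hmap : ContDiff ℝ ∞ fun q : ℝ × E => (q, (0 : C(I, E))) := contDiff_id.prodMk contDiff_const
  let W : Set (ℝ × E) := (fun q => (q, (0 : C(I, E)))) ⁻¹' e.target
  have hW : IsOpen W := e.open_target.preimage hmap.continuous
  have hW0 : ((0 : ℝ), x₀) ∈ W := by
    show (((0 : ℝ), x₀), (0 : C(I, E))) ∈ e.target
    rw [← he0]; exact e.map_source hea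
  let u : ℝ × E → C(I, E) := fun q => (e.symm (q, 0)).2
  have hu : ContDiffOn ℝ ∞ u W := contDiff_snd.comp_contDiffOn
    (hes.comp hmap.contDiffOn fun q hq => hq)
  have hu0 : u (0, x₀) = c₀ := by
    show (e.symm ((0, x₀), 0)).2 = c₀
    rw [← he0, e.left_inv hea]
  have huG : ∀ q ∈ W, e.symm (q, 0) = (q, u q) ∧
      u q = constCLM I E q.2 + q.1 • primitive E (fC.comp (u q)) := by
    intro q hq
    have h : G (e.symm (q, 0)) = (q, 0) := by rw [← heG]; exact e.right_inv hq
    have h1 : (e.symm (q, 0)).1 = q := congrArg Prod.fst h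
    have h2 := congrArg Prod.snd h
    simp only [G, h1] at h2
    refine ⟨Prod.ext h1 rfl, ?_⟩
    rw [sub_sub, sub_eq_zero] at h2
    exact h2
  obtain ⟨r, hr, hrs⟩ := Metric.isOpen_iff.1 e.open_source _ hea
  have hev : ∀ᶠ q in 𝓝 ((0 : ℝ), x₀), q ∈ W ∧ u q ∈ Metric.ball c₀ r := by
    have hcu : ContinuousAt u (0, x₀) := hu.continuousOn.continuousAt (hW.mem_nhds hW0)
    rw [ContinuousAt, hu0] at hcu
    exact (hW.eventually_mem hW0).and (hcu.eventually_mem (Metric.ball_mem_nhds c₀ hr))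
  obtain ⟨δ', hδ', hδ'u⟩ := Metric.eventually_nhds_iff_ball.1 hev
  let δ := min δ' r
  have hδ : 0 < δ := lt_min hδ' hr
  have hball : ∀ t x, |t| < δ → x ∈ Metric.ball x₀ δ → (t, x) ∈ Metric.ball ((0 : ℝ), x₀) δ := by
    intro t x ht hx
    rw [← ball_prod_same]
    exact ⟨by simpa using ht, hx⟩
  have hδu : ∀ q ∈ Metric.ball ((0 : ℝ), x₀) δ, q ∈ W ∧ u q ∈ Metric.ball c₀ r := fun q hq =>
    hδ'u q (Metric.ball_subset_ball (min_le_left _ _) hq)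
  have hscale : ∀ t x (s : I), |t| < δ → x ∈ Metric.ball x₀ δ →
      u (s * t, x) = (u (t, x)).comp (mulIcc s) := by
    intro t x s ht hx
    obtain ⟨h1, h2⟩ := hδu _ (hball t x ht hx)
    have hst : |s * t| < δ := by
      rw [abs_mul]
      exact (mul_le_of_le_one_left (abs_nonneg t) (abs_le.2 s.2)).trans_lt ht
    have hb := hball _ x hst hx
    have hsW := (hδu _ hb).1
    set v := (u (t, x)).comp (mulIcc s) with hv
    have hvs : ((s * t, x), v) ∈ e.source := by
      apply hrs
      rw [← ball_prod_same]
      refine ⟨Metric.ball_subset_ball (min_le_right _ _) hb, ?_⟩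
      refine Metric.mem_ball.2 (lt_of_le_of_lt ?_ (Metric.mem_ball.1 h2))
      refine (ContinuousMap.dist_le dist_nonneg).2 fun ρ => ?_
      exact (u (t, x)).dist_apply_le_dist (g := c₀) (mulIcc s ρ)
    have hev : e ((s * t, x), v) = ((s * t, x), 0) := by
      rw [heG]
      refine Prod.ext rfl ?_
      ext ρ
      have hρ : u (t, x) (mulIcc s ρ) =
          x + t • primitive E (fC.comp (u (t, x))) (mulIcc s ρ) :=
        DFunLike.congr_fun (huG _ h1).2 (mulIcc s ρ)
      have h3 := smul_primitive_comp_mulIcc (fC.comp (u (t, x))) s ρ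
      change u (t, x) (mulIcc s ρ) - x -
        ((s : ℝ) * t) • primitive E ((fC.comp (u (t, x))).comp (mulIcc s)) ρ = 0
      rw [hρ, mul_comm, mul_smul, h3]
      abel
    have : e.symm ((s * t, x), 0) = ((s * t, x), v) := by
      rw [← hev]; exact e.left_inv hvs
    exact congrArg Prod.snd this
  have h1I : (1 : ℝ) ∈ I := by simp [I]
  let ε := δ / 2
  have hε : 0 < ε := half_pos hδ
  have hεδ : ε < δ := half_lt_self hδ
  refine ⟨fun q => u q ⟨1, h1I⟩, ε, hε, ?_, ?_, ?_⟩
  · have hL : ContDiff ℝ ∞ (fun v : C(I, E) => v ⟨1, h1I⟩) :=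
      (ContinuousMap.evalCLM ℝ (⟨1, h1I⟩ : I) : C(I, E) →L[ℝ] E).contDiff
    exact hL.comp_contDiffOn (hu.mono fun q hq =>
      (hδu q (Metric.ball_subset_ball hεδ.le hq)).1)
  · intro x hx
    have h := (huG _ (hδu _ (hball 0 x (by simpa using hδ)
      (Metric.ball_subset_ball hεδ.le hx))).1).2
    show u (0, x) ⟨1, h1I⟩ = x
    rw [h]; simp
  · rintro ⟨t, x⟩ hq
    rw [← ball_prod_same] at hq
    obtain ⟨ht, hx⟩ := hq
    replace hx : x ∈ Metric.ball x₀ δ := Metric.ball_subset_ball hεδ.le hx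
    have hε' : |ε| < δ := by rwa [abs_of_pos hε]
    have hm : (-1 : ℝ) ≤ 1 := by norm_num
    let v := u (ε, x)
    have hvW := (huG _ (hδu _ (hball ε x hε' hx)).1).2
    have hF : ∀ τ ∈ Metric.ball (0 : ℝ) ε, τ / ε ∈ I ∧ 
        u (τ, x) ⟨1, h1I⟩ = v (projIcc (-1) 1 hm (τ / ε)) := by
      intro τ hτ
      have hτI : τ / ε ∈ I := by
        rw [mem_ball_zero_iff, Real.norm_eq_abs] at hτ
        refine abs_le.1 ?_
        rw [abs_div, abs_of_pos hε]
        exact (div_le_one hε).2 hτ.le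
      refine ⟨hτI, ?_⟩
      have h := hscale ε x ⟨τ / ε, hτI⟩ hε' hx
      simp only [div_mul_cancel₀ τ hε.ne'] at h
      rw [h, projIcc_of_mem hm hτI]
      simp [mulIcc, v]
    have hF' : ∀ τ ∈ Metric.ball (0 : ℝ) ε, u (τ, x) ⟨1, h1I⟩ =
        x + ε • ∫ ρ in (0 : ℝ)..(τ / ε), f (v (projIcc (-1) 1 hm ρ)) := by
      intro τ hτ
      obtain ⟨h1, h2⟩ := hF τ hτ
      rw [h2, projIcc_of_mem hm h1]
      have := DFunLike.congr_fun hvW ⟨τ / ε, h1⟩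
      exact this
    have hd : HasDerivAt (fun τ => x + ε • ∫ ρ in (0 : ℝ)..(τ / ε), f (v (projIcc (-1) 1 hm ρ)))
        (f (u (t, x) ⟨1, h1I⟩)) t := by
      have hc : Continuous fun ρ => f (v (projIcc (-1) 1 hm ρ)) :=
        hf.continuous.comp v.continuous_extend_projIcc
      have h := (hc.integral_hasStrictDerivAt 0 (t / ε)).hasDerivAt
      have h' := ((h.scomp t ((hasDerivAt_id t).div_const ε)).const_smul ε).const_add x
      refine h'.congr_deriv ?_
      rw [(hF t ht).2, smul_smul, mul_one_div, div_self hε.ne', one_smul]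
    refine hd.congr_of_eventuallyEq ?_
    filter_upwards [Metric.isOpen_ball.mem_nhds ht] with τ hτ using hF' τ hτ

end Flow

section Pushforward

variable {E : Type*} [NormedAddCommGroup E] [NormedSpace ℝ E]

theorem fderiv_flow_apply_time {f : E → E} {Φ : ℝ × E → E} {U : Set (ℝ × E)} (hU : IsOpen U)
    (hΦ : ContDiffOn ℝ ∞ Φ U)
    (hd : ∀ q ∈ U, HasDerivAt (fun t => Φ (t, q.2)) (f (Φ q)) q.1) {q : ℝ × E} (hq : q ∈ U) :
    fderiv ℝ Φ q (1, 0) = f (Φ q) := by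
  have h1 : HasFDerivAt Φ (fderiv ℝ Φ q) (q.1, q.2) :=
    ((hΦ.contDiffAt (hU.mem_nhds hq)).differentiableAt (by simp)).hasFDerivAt
  have h2 : HasDerivAt (fun t : ℝ => (t, q.2)) ((1 : ℝ), (0 : E)) q.1 :=
    (hasDerivAt_id q.1).prodMk (hasDerivAt_const q.1 q.2)
  exact (h1.comp_hasDerivAt q.1 h2).unique (hd q hq)

theorem hasDerivAt_fderiv_flow_apply {f : E → E} (hf : Differentiable ℝ f) {Φ : ℝ × E → E}
    {U : Set (ℝ × E)} (hU : IsOpen U) (hΦ : ContDiffOn ℝ ∞ Φ U)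
    (hd : ∀ q ∈ U, HasDerivAt (fun t => Φ (t, q.2)) (f (Φ q)) q.1) {q : ℝ × E} (hq : q ∈ U)
    (v : E) :
    HasDerivAt (fun t => fderiv ℝ Φ (t, q.2) (0, v))
      (fderiv ℝ f (Φ q) (fderiv ℝ Φ q (0, v))) q.1 := by
  have hc : ContDiffAt ℝ ∞ Φ q := hΦ.contDiffAt (hU.mem_nhds hq)
  have h1 : HasFDerivAt (fderiv ℝ Φ) (fderiv ℝ (fderiv ℝ Φ) q) (q.1, q.2) :=
    ((hc.fderiv_right (m := 1) (by norm_cast)).differentiableAt (by simp)).hasFDerivAt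
  have h2 : HasDerivAt (fun t : ℝ => (t, q.2)) ((1 : ℝ), (0 : E)) q.1 :=
    (hasDerivAt_id q.1).prodMk (hasDerivAt_const q.1 q.2)
  have h3 : HasDerivAt (fun t => fderiv ℝ Φ (t, q.2)) (fderiv ℝ (fderiv ℝ Φ) q (1, 0)) q.1 :=
    h1.comp_hasDerivAt q.1 h2
  have hs : IsSymmSndFDerivAt ℝ Φ q := hc.isSymmSndFDerivAt (by
    rw [minSmoothness_of_isRCLikeNormedField]; exact ENat.LEInfty.out)
  have h4 : HasFDerivAt (fun r => fderiv ℝ Φ r ((1 : ℝ), (0 : E)))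
      ((fderiv ℝ f (Φ q)).comp (fderiv ℝ Φ q)) q := by
    have := (hf (Φ q)).hasFDerivAt.comp q (hc.differentiableAt (by simp)).hasFDerivAt
    refine this.congr_of_eventuallyEq ?_
    filter_upwards [hU.mem_nhds hq] with r hr using fderiv_flow_apply_time hU hΦ hd hr
  have h5 : HasFDerivAt (fun r => fderiv ℝ Φ r ((1 : ℝ), (0 : E)))
      ((ContinuousLinearMap.apply ℝ E ((1 : ℝ), (0 : E))).comp (fderiv ℝ (fderiv ℝ Φ) q)) q :=
    (ContinuousLinearMap.apply ℝ E ((1 : ℝ), (0 : E))).hasFDerivAt.comp q h1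
  have h6 : fderiv ℝ (fderiv ℝ Φ) q (0, v) (1, 0) =
      fderiv ℝ f (Φ q) (fderiv ℝ Φ q (0, v)) := DFunLike.congr_fun (h5.unique h4) ((0 : ℝ), v)
  rw [← h6, ← hs.eq (1, 0) (0, v)]
  exact (ContinuousLinearMap.apply ℝ E ((0 : ℝ), v)).hasFDerivAt.comp_hasDerivAt q.1 h3

theorem fderiv_flow_zero_apply {Φ : ℝ × E → E} {x₀ : E} {ε : ℝ}
    (hΦ : ContDiffOn ℝ ∞ Φ (Metric.ball (0, x₀) ε))
    (h0 : ∀ x ∈ Metric.ball x₀ ε, Φ (0, x) = x) {x : E} (hx : x ∈ Metric.ball x₀ ε) (v : E) :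
    fderiv ℝ Φ (0, x) (0, v) = v := by
  have hm0 : ((0 : ℝ), x) ∈ Metric.ball ((0 : ℝ), x₀) ε := by
    rw [← ball_prod_same]
    exact ⟨Metric.mem_ball_self (Metric.pos_of_mem_ball hx), hx⟩
  have h1 : HasFDerivAt Φ (fderiv ℝ Φ (0, x)) (0, x) :=
    ((hΦ.contDiffAt (Metric.isOpen_ball.mem_nhds hm0)).differentiableAt (by simp)).hasFDerivAt
  have h2 : HasFDerivAt (fun y : E => ((0 : ℝ), y)) (ContinuousLinearMap.inr ℝ ℝ E) x :=
    hasFDerivAt_prodMk_right 0 x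
  have h3 : HasFDerivAt (fun y => Φ (0, y)) (ContinuousLinearMap.id ℝ E) x := by
    refine (hasFDerivAt_id x).congr_of_eventuallyEq ?_
    filter_upwards [Metric.isOpen_ball.mem_nhds hx] with y hy using h0 y hy
  exact DFunLike.congr_fun ((h1.comp x h2).unique h3) v

/-- The flow of `f` preserves every vector field commuting with `f`. -/
theorem fderiv_flow_apply_of_commute {f ζ : E → E} (hf : ContDiff ℝ ∞ f) (hζ : Differentiable ℝ ζ)
    (hc : ∀ x, fderiv ℝ ζ x (f x) = fderiv ℝ f x (ζ x)) {Φ : ℝ × E → E} {x₀ : E} {ε : ℝ}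
    (hΦ : ContDiffOn ℝ ∞ Φ (Metric.ball (0, x₀) ε))
    (h0 : ∀ x ∈ Metric.ball x₀ ε, Φ (0, x) = x)
    (hd : ∀ q ∈ Metric.ball ((0 : ℝ), x₀) ε, HasDerivAt (fun t => Φ (t, q.2)) (f (Φ q)) q.1)
    {q : ℝ × E} (hq : q ∈ Metric.ball (0, x₀) ε) :
    fderiv ℝ Φ q (0, ζ q.2) = ζ (Φ q) := by
  obtain ⟨t, x⟩ := q
  have hq' := hq
  rw [← ball_prod_same] at hq'
  obtain ⟨ht, hx⟩ := hq'
  simp only at ht hx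
  rw [mem_ball_zero_iff, Real.norm_eq_abs] at ht
  obtain ⟨b, hb, hbε⟩ := exists_between ht
  have hb0 : 0 < b := (abs_nonneg t).trans_lt hb
  have hmem : ∀ s ∈ Icc (-b) b, (s, x) ∈ Metric.ball ((0 : ℝ), x₀) ε := by
    intro s hs
    rw [← ball_prod_same]
    refine ⟨?_, hx⟩
    rw [mem_ball_zero_iff, Real.norm_eq_abs]
    exact (abs_le.2 hs).trans_lt hbε
  have hcont : ContinuousOn (fun s : ℝ => fderiv ℝ f (Φ (s, x))) (Icc (-b) b) := by
    refine (hf.continuous_fderiv (by simp)).comp_continuousOn ?_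
    exact hΦ.continuousOn.comp (by fun_prop) hmem
  obtain ⟨K, hK⟩ := isCompact_Icc.exists_bound_of_continuousOn hcont
  have key : EqOn (fun s => fderiv ℝ Φ (s, x) (0, ζ x)) (fun s => ζ (Φ (s, x))) (Ioo (-b) b) := by
    refine ODE_solution_unique_of_mem_Ioo (v := fun s w => fderiv ℝ f (Φ (s, x)) w)
      (s := fun _ => univ) (K := K.toNNReal) (t₀ := 0) ?_ ⟨by linarith, hb0⟩ ?_ ?_ ?_
    · intro s hs
      refine LipschitzWith.lipschitzOnWith ?_
      refine (fderiv ℝ f (Φ (s, x))).lipschitz.weaken ?_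
      rw [← NNReal.coe_le_coe]
      exact (hK s (Ioo_subset_Icc_self hs)).trans (Real.le_coe_toNNReal K)
    · intro s hs
      exact ⟨hasDerivAt_fderiv_flow_apply (hf.differentiable (by simp)) Metric.isOpen_ball hΦ hd
        (hmem s (Ioo_subset_Icc_self hs)) _, mem_univ _⟩
    · intro s hs
      refine ⟨?_, mem_univ _⟩
      have := (hζ (Φ (s, x))).hasFDerivAt.comp_hasDerivAt s
        (hd _ (hmem s (Ioo_subset_Icc_self hs)))
      exact this.congr_deriv (hc _)
    · simp only [h0 x hx, fderiv_flow_zero_apply hΦ h0 hx]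
  exact key (abs_lt.1 hb)

/-- Flowing along `f` to the zero level set of a function `T` with `dT(f) = 1` gives a projection
killing `f` and preserving all the fields which commute with `f` and are tangent to the levels
of `T`. -/
theorem ContDiff.exists_projection_along [CompleteSpace E] {f : E → E} (hf : ContDiff ℝ ∞ f)
    {T : E → ℝ} (hT : ContDiff ℝ ∞ T) (hTf : ∀ x, fderiv ℝ T x (f x) = 1) {p : E} (hp : T p = 0) :
    ∃ (U : Set E) (Q : E → E), IsOpen U ∧ p ∈ U ∧ ContDiffOn ℝ ∞ Q U ∧ Q p = p ∧
      (∀ x ∈ U, fderiv ℝ Q x (f x) = 0) ∧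
      (∀ ζ : E → E, Differentiable ℝ ζ → (∀ x, fderiv ℝ ζ x (f x) = fderiv ℝ f x (ζ x)) →
        (∀ x, fderiv ℝ T x (ζ x) = 0) → ∀ x ∈ U, fderiv ℝ Q x (ζ x) = ζ (Q x)) ∧
      ∀ v, fderiv ℝ Q p v = v - fderiv ℝ T p v • f p := by
  obtain ⟨Φ, ε, hε, hΦ, h0, hd⟩ := hf.exists_contDiffOn_flow p
  have hσ : ContDiff ℝ ∞ fun x => (-T x, x) := hT.neg.prodMk contDiff_id
  let U : Set E := (fun x => (-T x, x)) ⁻¹' Metric.ball ((0 : ℝ), p) ε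
  have hU : IsOpen U := Metric.isOpen_ball.preimage hσ.continuous
  have hpU : p ∈ U := by simp [U, hp, hε]
  have hD : ∀ x ∈ U, ∀ v, fderiv ℝ (fun x => Φ (-T x, x)) x v =
      fderiv ℝ Φ (-T x, x) (0, v) - fderiv ℝ T x v • f (Φ (-T x, x)) := by
    intro x hx v
    have h1 : HasFDerivAt Φ (fderiv ℝ Φ (-T x, x)) (-T x, x) :=
      ((hΦ.contDiffAt (Metric.isOpen_ball.mem_nhds hx)).differentiableAt (by simp)).hasFDerivAt
    have h2 : HasFDerivAt (fun x => (-T x, x))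
        ((-fderiv ℝ T x).prod (ContinuousLinearMap.id ℝ E)) x :=
      (hT.differentiable (by simp) x).hasFDerivAt.neg.prodMk (hasFDerivAt_id x)
    have h4 : fderiv ℝ (fun x => Φ (-T x, x)) x = _ :=
      (HasFDerivAt.comp (f := fun x => (-T x, x)) x h1 h2).fderiv
    rw [h4]
    have h3 : ((-fderiv ℝ T x).prod (ContinuousLinearMap.id ℝ E)) v =
        (0, v) - fderiv ℝ T x v • ((1 : ℝ), (0 : E)) := by ext <;> simp
    rw [ContinuousLinearMap.comp_apply, h3, map_sub, map_smul,
      fderiv_flow_apply_time Metric.isOpen_ball hΦ hd hx]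
  have hpush : ∀ ζ : E → E, Differentiable ℝ ζ →
      (∀ x, fderiv ℝ ζ x (f x) = fderiv ℝ f x (ζ x)) → ∀ x ∈ U,
      fderiv ℝ Φ (-T x, x) (0, ζ x) = ζ (Φ (-T x, x)) := fun ζ hζ hc x hx =>
    fderiv_flow_apply_of_commute hf hζ hc hΦ h0 hd hx
  refine ⟨U, fun x => Φ (-T x, x), hU, hpU, hΦ.comp hσ.contDiffOn fun x hx => hx, ?_, ?_, ?_, ?_⟩
  · simp [hp, h0 p (Metric.mem_ball_self hε)]
  · intro x hx
    rw [hD x hx, hpush f (hf.differentiable (by simp)) (fun _ => rfl) x hx, hTf, one_smul,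
      sub_self]
  · intro ζ hζ hc hTζ x hx
    rw [hD x hx, hpush ζ hζ hc x hx, hTζ, zero_smul, sub_zero]
  · intro v
    rw [hD p hpU]
    simp only [hp, neg_zero, h0 p (Metric.mem_ball_self hε),
      fderiv_flow_zero_apply hΦ h0 (Metric.mem_ball_self hε)]

end Pushforward

section Killing

variable {E : Type*} [NormedAddCommGroup E] [NormedSpace ℝ E]

/-- Two commuting vector fields with dual functions `T`, `P` have a smooth local retraction onto
the common zero level set of `T` and `P` whose fibres are tangent to them. -/
theorem ContDiff.exists_projection_along_pair [CompleteSpace E] {ξ η : E → E}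
    (hξ : ContDiff ℝ ∞ ξ) (hη : ContDiff ℝ ∞ η)
    (hcomm : ∀ x, fderiv ℝ η x (ξ x) = fderiv ℝ ξ x (η x)) {T P : E → ℝ}
    (hT : ContDiff ℝ ∞ T) (hP : ContDiff ℝ ∞ P)
    (hTξ : ∀ x, fderiv ℝ T x (ξ x) = 1) (hTη : ∀ x, fderiv ℝ T x (η x) = 0)
    (hPξ : ∀ x, fderiv ℝ P x (ξ x) = 0) (hPη : ∀ x, fderiv ℝ P x (η x) = 1)
    {p : E} (hTp : T p = 0) (hPp : P p = 0) :
    ∃ (U : Set E) (R : E → E), IsOpen U ∧ p ∈ U ∧ ContDiffOn ℝ ∞ R U ∧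
      (∀ x ∈ U, fderiv ℝ R x (ξ x) = 0) ∧ (∀ x ∈ U, fderiv ℝ R x (η x) = 0) ∧
      ∀ v, fderiv ℝ R p v = v - fderiv ℝ T p v • ξ p - fderiv ℝ P p v • η p := by
  obtain ⟨U₁, Q₁, hU₁, hpU₁, hQ₁, hQ₁p, hQ₁ξ, hQ₁ζ, hQ₁D⟩ := hξ.exists_projection_along hT hTξ hTp
  obtain ⟨U₂, Q₂, hU₂, hpU₂, hQ₂, -, hQ₂η, -, hQ₂D⟩ := hη.exists_projection_along hP hPη hPp
  have hD : ∀ x ∈ U₁ ∩ Q₁ ⁻¹' U₂,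
      fderiv ℝ (Q₂ ∘ Q₁) x = (fderiv ℝ Q₂ (Q₁ x)).comp (fderiv ℝ Q₁ x) := by
    intro x hx
    exact fderiv_comp x ((hQ₂.contDiffAt (hU₂.mem_nhds hx.2)).differentiableAt (by simp))
      ((hQ₁.contDiffAt (hU₁.mem_nhds hx.1)).differentiableAt (by simp))
  have hp : p ∈ U₁ ∩ Q₁ ⁻¹' U₂ := ⟨hpU₁, by rwa [mem_preimage, hQ₁p]⟩
  refine ⟨U₁ ∩ Q₁ ⁻¹' U₂, Q₂ ∘ Q₁, hQ₁.continuousOn.isOpen_inter_preimage hU₁ hU₂, hp,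
    hQ₂.comp (hQ₁.mono inter_subset_left) fun x hx => hx.2, fun x hx => ?_, fun x hx => ?_,
    fun v => ?_⟩
  · rw [hD x hx, ContinuousLinearMap.comp_apply, hQ₁ξ x hx.1, map_zero]
  · rw [hD x hx, ContinuousLinearMap.comp_apply,
      hQ₁ζ η (hη.differentiable (by simp)) hcomm hTη x hx.1, hQ₂η _ hx.2]
  · rw [hD p hp, ContinuousLinearMap.comp_apply, hQ₁D, hQ₁p, hQ₂D, map_sub, map_smul, hPξ,
      smul_zero, sub_zero]

/-- Cartan's formula for the exterior derivative of a one-form on two fields on which it is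
constant. -/
theorem fderiv_apply_sub_fderiv_apply {α : E → E →L[ℝ] ℝ} (hα : Differentiable ℝ α) {X Y : E → E}
    (hX : Differentiable ℝ X) (hY : Differentiable ℝ Y) {c d : ℝ} (hαX : ∀ x, α x (X x) = c)
    (hαY : ∀ x, α x (Y x) = d) (x : E) :
    fderiv ℝ α x (X x) (Y x) - fderiv ℝ α x (Y x) (X x) =
      α x (fderiv ℝ X x (Y x) - fderiv ℝ Y x (X x)) := by
  have key : ∀ {Z : E → E} {e : ℝ}, Differentiable ℝ Z → (∀ y, α y (Z y) = e) → ∀ v,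
      α x (fderiv ℝ Z x v) + fderiv ℝ α x v (Z x) = 0 := by
    intro Z e hZ he v
    have h1 := (hα x).hasFDerivAt.clm_apply (hZ x).hasFDerivAt
    have h2 : HasFDerivAt (fun y => α y (Z y)) (0 : E →L[ℝ] ℝ) x := by
      simpa only [he] using hasFDerivAt_const e x
    simpa using DFunLike.congr_fun (h1.unique h2) v
  have h1 := key hX hαX (Y x)
  have h2 := key hY hαY (X x)
  rw [map_sub]
  linarith

/-- If `α₁, α₂` are dual to commuting fields `ξ, η`, and if brackets of `ξ`, `η` and of sections of
`ker α₁ ∩ ker α₂` with sections of `ker α₁ ∩ ker α₂` remain in `ker α₁ ∩ ker α₂`, then one-forms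
which are constant on `ξ` and `η` and vanish on `ker α₁ ∩ ker α₂` are closed. -/
theorem fderiv_symm_of_bracket {α₁ α₂ β : E → E →L[ℝ] ℝ} (hα₁ : ContDiff ℝ ∞ α₁)
    (hα₂ : ContDiff ℝ ∞ α₂) (hβ : Differentiable ℝ β) {ξ η : E → E}
    (hξ : ContDiff ℝ ∞ ξ) (hη : ContDiff ℝ ∞ η)
    (h₁ξ : ∀ x, α₁ x (ξ x) = 1) (h₁η : ∀ x, α₁ x (η x) = 0)
    (h₂ξ : ∀ x, α₂ x (ξ x) = 0) (h₂η : ∀ x, α₂ x (η x) = 1)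
    {c d : ℝ} (hβξ : ∀ x, β x (ξ x) = c) (hβη : ∀ x, β x (η x) = d)
    (hβW : ∀ x v, α₁ x v = 0 → α₂ x v = 0 → β x v = 0)
    (hcomm : ∀ x, fderiv ℝ η x (ξ x) = fderiv ℝ ξ x (η x))
    (hξW : ∀ X : E → E, ContDiff ℝ ∞ X → (∀ x, α₁ x (X x) = 0 ∧ α₂ x (X x) = 0) → ∀ x,
      α₁ x (fderiv ℝ X x (ξ x) - fderiv ℝ ξ x (X x)) = 0 ∧
      α₂ x (fderiv ℝ X x (ξ x) - fderiv ℝ ξ x (X x)) = 0)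
    (hηW : ∀ X : E → E, ContDiff ℝ ∞ X → (∀ x, α₁ x (X x) = 0 ∧ α₂ x (X x) = 0) → ∀ x,
      α₁ x (fderiv ℝ X x (η x) - fderiv ℝ η x (X x)) = 0 ∧
      α₂ x (fderiv ℝ X x (η x) - fderiv ℝ η x (X x)) = 0)
    (hWW : ∀ X Y : E → E, ContDiff ℝ ∞ X → ContDiff ℝ ∞ Y →
      (∀ x, α₁ x (X x) = 0 ∧ α₂ x (X x) = 0) → (∀ x, α₁ x (Y x) = 0 ∧ α₂ x (Y x) = 0) → ∀ x,
      α₁ x (fderiv ℝ Y x (X x) - fderiv ℝ X x (Y x)) = 0 ∧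
      α₂ x (fderiv ℝ Y x (X x) - fderiv ℝ X x (Y x)) = 0)
    (x u v : E) : fderiv ℝ β x u v = fderiv ℝ β x v u := by
  have hξd := hξ.differentiable (by simp)
  have hηd := hη.differentiable (by simp)
  let X : E → E → E := fun w y => w - α₁ y w • ξ y - α₂ y w • η y
  have hX : ∀ w, ContDiff ℝ ∞ (X w) := fun w => by fun_prop
  have hXd : ∀ w, Differentiable ℝ (X w) := fun w => (hX w).differentiable (by simp)
  have hXW : ∀ w y, α₁ y (X w y) = 0 ∧ α₂ y (X w y) = 0 := fun w y => by
    simp [X, h₁ξ, h₁η, h₂ξ, h₂η]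
  have hβX : ∀ w y, β y (X w y) = 0 := fun w y => hβW y _ (hXW w y).1 (hXW w y).2
  have dec : ∀ w, w = α₁ x w • ξ x + α₂ x w • η x + X w x := fun w => by simp [X]
  have e1 : fderiv ℝ β x (ξ x) (η x) - fderiv ℝ β x (η x) (ξ x) = 0 := by
    rw [fderiv_apply_sub_fderiv_apply hβ hξd hηd hβξ hβη, hcomm, sub_self, map_zero]
  have e2 : ∀ w, fderiv ℝ β x (ξ x) (X w x) - fderiv ℝ β x (X w x) (ξ x) = 0 := fun w => by
    obtain ⟨h1, h2⟩ := hξW (X w) (hX w) (hXW w) x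
    rw [fderiv_apply_sub_fderiv_apply hβ hξd (hXd w) hβξ (hβX w), ← neg_sub, map_neg,
      hβW x _ h1 h2, neg_zero]
  have e3 : ∀ w, fderiv ℝ β x (η x) (X w x) - fderiv ℝ β x (X w x) (η x) = 0 := fun w => by
    obtain ⟨h1, h2⟩ := hηW (X w) (hX w) (hXW w) x
    rw [fderiv_apply_sub_fderiv_apply hβ hηd (hXd w) hβη (hβX w), ← neg_sub, map_neg,
      hβW x _ h1 h2, neg_zero]
  have e4 : fderiv ℝ β x (X u x) (X v x) - fderiv ℝ β x (X v x) (X u x) = 0 := by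
    obtain ⟨h1, h2⟩ := hWW (X v) (X u) (hX v) (hX u) (hXW v) (hXW u) x
    rw [fderiv_apply_sub_fderiv_apply hβ (hXd u) (hXd v) (hβX u) (hβX v), hβW x _ h1 h2]
  rw [← sub_eq_zero]
  conv_lhs => rw [dec u, dec v]
  simp only [map_add, map_smul, add_apply, smul_apply,
    smul_eq_mul]
  linear_combination (α₁ x u * α₂ x v - α₁ x v * α₂ x u) * e1 + α₁ x u * e2 v - α₁ x v * e2 u +
    α₂ x u * e3 v - α₂ x v * e3 u + e4

/-- A field `f` is Killing for the field of bilinear forms `B`. -/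
def IsKilling (B : E → E →L[ℝ] E →L[ℝ] ℝ) (f : E → E) : Prop :=
  ∀ x u v, fderiv ℝ B x (f x) u v + B x (fderiv ℝ f x u) v + B x u (fderiv ℝ f x v) = 0

theorem IsKilling.apply_bracket_eq_zero {B : E → E →L[ℝ] E →L[ℝ] ℝ} (hB : Differentiable ℝ B)
    {f ζ X : E → E} (hf : IsKilling B f) (hζ : Differentiable ℝ ζ)
    (hX : Differentiable ℝ X) (hc : ∀ x, fderiv ℝ ζ x (f x) = fderiv ℝ f x (ζ x))
    (hXζ : ∀ x, B x (ζ x) (X x) = 0) (x : E) :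
    B x (ζ x) (fderiv ℝ X x (f x) - fderiv ℝ f x (X x)) = 0 := by
  have h1 := ((hB x).hasFDerivAt.clm_apply (hζ x).hasFDerivAt).clm_apply (hX x).hasFDerivAt
  have h2 : HasFDerivAt (fun y => B y (ζ y) (X y)) (0 : E →L[ℝ] ℝ) x := by
    simpa only [hXζ] using hasFDerivAt_const (0 : ℝ) x
  have h3 := DFunLike.congr_fun (h1.unique h2) (f x)
  have h4 := hf x (ζ x) (X x)
  simp [hc] at h3
  rw [map_sub]
  linarith

/-- Orthogonally transitive commuting Killing fields have dual coordinate functions which are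
constant along the orthogonal distribution. -/
theorem IsKilling.exists_dual_functions {B : E → E →L[ℝ] E →L[ℝ] ℝ} (hB : ContDiff ℝ ∞ B)
    (hsymm : ∀ x u v, B x u v = B x v u) {ξ η : E → E} (hξ : ContDiff ℝ ∞ ξ)
    (hη : ContDiff ℝ ∞ η) (hKξ : IsKilling B ξ) (hKη : IsKilling B η)
    (hcomm : ∀ x, fderiv ℝ η x (ξ x) = fderiv ℝ ξ x (η x))
    (hnd : ∀ x, B x (ξ x) (ξ x) * B x (η x) (η x) - B x (ξ x) (η x) ^ 2 ≠ 0)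
    (hOT : ∀ X Y : E → E, ContDiff ℝ ∞ X → ContDiff ℝ ∞ Y →
      (∀ x, B x (ξ x) (X x) = 0 ∧ B x (η x) (X x) = 0) →
      (∀ x, B x (ξ x) (Y x) = 0 ∧ B x (η x) (Y x) = 0) → ∀ x,
      B x (ξ x) (fderiv ℝ Y x (X x) - fderiv ℝ X x (Y x)) = 0 ∧
      B x (η x) (fderiv ℝ Y x (X x) - fderiv ℝ X x (Y x)) = 0) (p : E) :
    ∃ T P : E → ℝ, ContDiff ℝ ∞ T ∧ ContDiff ℝ ∞ P ∧ T p = 0 ∧ P p = 0 ∧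
      (∀ x, fderiv ℝ T x (ξ x) = 1) ∧ (∀ x, fderiv ℝ T x (η x) = 0) ∧
      (∀ x, fderiv ℝ P x (ξ x) = 0) ∧ (∀ x, fderiv ℝ P x (η x) = 1) ∧
      ∀ x v, (fderiv ℝ T x v = 0 ∧ fderiv ℝ P x v = 0) ↔
        (B x (ξ x) v = 0 ∧ B x (η x) v = 0) := by
  let D : E → ℝ := fun x => B x (ξ x) (ξ x) * B x (η x) (η x) - B x (ξ x) (η x) ^ 2
  have hD : ContDiff ℝ ∞ D := by fun_prop
  let α₁ : E → E →L[ℝ] ℝ := fun x =>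
    (D x)⁻¹ • (B x (η x) (η x) • B x (ξ x) - B x (ξ x) (η x) • B x (η x))
  let α₂ : E → E →L[ℝ] ℝ := fun x =>
    (D x)⁻¹ • (B x (ξ x) (ξ x) • B x (η x) - B x (ξ x) (η x) • B x (ξ x))
  have hα₁ : ContDiff ℝ ∞ α₁ := (hD.inv hnd).smul (by fun_prop)
  have hα₂ : ContDiff ℝ ∞ α₂ := (hD.inv hnd).smul (by fun_prop)
  have a₁ : ∀ x v, α₁ x v = (D x)⁻¹ * (B x (η x) (η x) * B x (ξ x) v -
    B x (ξ x) (η x) * B x (η x) v) := fun x v => by simp [α₁]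
  have a₂ : ∀ x v, α₂ x v = (D x)⁻¹ * (B x (ξ x) (ξ x) * B x (η x) v -
    B x (ξ x) (η x) * B x (ξ x) v) := fun x v => by simp [α₂]
  have h₁ξ : ∀ x, α₁ x (ξ x) = 1 := fun x => by
    rw [a₁, inv_mul_eq_one₀ (hnd x), hsymm x (η x) (ξ x)]; ring
  have h₁η : ∀ x, α₁ x (η x) = 0 := fun x => by rw [a₁]; ring
  have h₂ξ : ∀ x, α₂ x (ξ x) = 0 := fun x => by rw [a₂, hsymm x (η x) (ξ x)]; ring
  have h₂η : ∀ x, α₂ x (η x) = 1 := fun x => by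
    rw [a₂, inv_mul_eq_one₀ (hnd x)]; ring
  have hiff : ∀ x v, (α₁ x v = 0 ∧ α₂ x v = 0) ↔ (B x (ξ x) v = 0 ∧ B x (η x) v = 0) := by
    intro x v
    constructor
    · rintro ⟨h1, h2⟩
      rw [a₁, mul_eq_zero, or_iff_right (inv_ne_zero (hnd x))] at h1
      rw [a₂, mul_eq_zero, or_iff_right (inv_ne_zero (hnd x))] at h2
      constructor <;> refine (mul_eq_zero.1 ?_).resolve_left (hnd x)
      · linear_combination B x (ξ x) (ξ x) * h1 + B x (ξ x) (η x) * h2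
      · linear_combination B x (ξ x) (η x) * h1 + B x (η x) (η x) * h2
    · rintro ⟨h1, h2⟩
      simp [a₁, a₂, h1, h2]
  have hBd := hB.differentiable (by simp)
  have hξd := hξ.differentiable (by simp)
  have hηd := hη.differentiable (by simp)
  have hξW : ∀ X : E → E, ContDiff ℝ ∞ X → (∀ x, α₁ x (X x) = 0 ∧ α₂ x (X x) = 0) → ∀ x,
      α₁ x (fderiv ℝ X x (ξ x) - fderiv ℝ ξ x (X x)) = 0 ∧
      α₂ x (fderiv ℝ X x (ξ x) - fderiv ℝ ξ x (X x)) = 0 := by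
    intro X hX hXW x
    simp only [hiff] at hXW ⊢
    have hXd := hX.differentiable (by simp)
    exact ⟨hKξ.apply_bracket_eq_zero hBd hξd hXd (fun _ => rfl) (fun x => (hXW x).1) x,
      hKξ.apply_bracket_eq_zero hBd hηd hXd hcomm (fun x => (hXW x).2) x⟩
  have hηW : ∀ X : E → E, ContDiff ℝ ∞ X → (∀ x, α₁ x (X x) = 0 ∧ α₂ x (X x) = 0) → ∀ x,
      α₁ x (fderiv ℝ X x (η x) - fderiv ℝ η x (X x)) = 0 ∧
      α₂ x (fderiv ℝ X x (η x) - fderiv ℝ η x (X x)) = 0 := by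
    intro X hX hXW x
    simp only [hiff] at hXW ⊢
    have hXd := hX.differentiable (by simp)
    exact ⟨hKη.apply_bracket_eq_zero hBd hξd hXd (fun x => (hcomm x).symm)
      (fun x => (hXW x).1) x,
      hKη.apply_bracket_eq_zero hBd hηd hXd (fun _ => rfl) (fun x => (hXW x).2) x⟩
  have hWW : ∀ X Y : E → E, ContDiff ℝ ∞ X → ContDiff ℝ ∞ Y →
      (∀ x, α₁ x (X x) = 0 ∧ α₂ x (X x) = 0) → (∀ x, α₁ x (Y x) = 0 ∧ α₂ x (Y x) = 0) → ∀ x,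
      α₁ x (fderiv ℝ Y x (X x) - fderiv ℝ X x (Y x)) = 0 ∧
      α₂ x (fderiv ℝ Y x (X x) - fderiv ℝ X x (Y x)) = 0 := by
    simp only [hiff]
    exact hOT
  have hpot : ∀ {β : E → E →L[ℝ] ℝ}, ContDiff ℝ ∞ β →
      (∀ x u v, fderiv ℝ β x u v = fderiv ℝ β x v u) →
      ∃ F : E → ℝ, ContDiff ℝ ∞ F ∧ F p = 0 ∧ ∀ x, fderiv ℝ F x = β x := by
    intro β hβ hs
    obtain ⟨F, hF⟩ := convex_univ.exists_forall_hasFDerivAt_of_fderiv_symmetric isOpen_univ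
      (hβ.differentiable (by simp)).differentiableOn fun x _ u v => hs x u v
    have hF' : ∀ x, HasFDerivAt (fun y => F y - F p) (β x) x := fun x =>
      (hF x (mem_univ x)).sub_const _
    refine ⟨fun y => F y - F p, ?_, sub_self _, fun x => (hF' x).fderiv⟩
    refine contDiff_infty_iff_fderiv.2 ⟨fun x => (hF' x).differentiableAt, ?_⟩
    rwa [funext fun x => (hF' x).fderiv]
  obtain ⟨T, hT, hTp, hdT⟩ := hpot hα₁ <| fderiv_symm_of_bracket hα₁ hα₂
    (hα₁.differentiable (by simp)) hξ hη h₁ξ h₁η h₂ξ h₂η h₁ξ h₁η (fun _ _ h _ => h) hcomm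
    hξW hηW hWW
  obtain ⟨P, hP, hPp, hdP⟩ := hpot hα₂ <| fderiv_symm_of_bracket hα₁ hα₂
    (hα₂.differentiable (by simp)) hξ hη h₁ξ h₁η h₂ξ h₂η h₂ξ h₂η (fun _ _ _ h => h) hcomm
    hξW hηW hWW
  refine ⟨T, P, hT, hP, hTp, hPp, ?_⟩
  simp only [hdT, hdP]
  exact ⟨h₁ξ, h₁η, h₂ξ, h₂η, hiff⟩

end Killing

section Chart

theorem exists_linearMap_injOn_ker {α₁ α₂ : (Fin 4 → ℝ) →ₗ[ℝ] ℝ} {u w : Fin 4 → ℝ}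
    (h₁u : α₁ u = 1) (h₁w : α₁ w = 0) (h₂u : α₂ u = 0) (h₂w : α₂ w = 1) :
    ∃ M : (Fin 4 → ℝ) →ₗ[ℝ] (Fin 2 → ℝ), ∀ v, α₁ v = 0 → α₂ v = 0 → M v = 0 → v = 0 := by
  have hr : LinearMap.range (α₁.prod α₂) = ⊤ := by
    rw [LinearMap.range_eq_top]
    rintro ⟨a, b⟩
    exact ⟨a • u + b • w, by simp [h₁u, h₁w, h₂u, h₂w]⟩
  have hk := LinearMap.finrank_range_add_finrank_ker (α₁.prod α₂)
  rw [hr, finrank_top, Module.finrank_prod, Module.finrank_self, Module.finrank_fin_fun] at hk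
  have hk2 : Module.finrank ℝ (LinearMap.ker (α₁.prod α₂)) = Module.finrank ℝ (Fin 2 → ℝ) := by
    rw [Module.finrank_fin_fun]; omega
  let κ := LinearEquiv.ofFinrankEq _ _ hk2
  obtain ⟨M, hM⟩ := κ.toLinearMap.exists_extend
  refine ⟨M, fun v h1 h2 hv => ?_⟩
  have hm : v ∈ LinearMap.ker (α₁.prod α₂) := by simp [h1, h2]
  have h3 : κ ⟨v, hm⟩ = 0 := by
    rw [← hv]
    exact (DFunLike.congr_fun hM ⟨v, hm⟩).symm
  simpa using h3

theorem ContDiff.exists_adapted_chart {ξ η : (Fin 4 → ℝ) → Fin 4 → ℝ}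
    (hξ : ContDiff ℝ ∞ ξ) (hη : ContDiff ℝ ∞ η)
    (hcomm : ∀ x, fderiv ℝ η x (ξ x) = fderiv ℝ ξ x (η x)) {T P : (Fin 4 → ℝ) → ℝ}
    (hT : ContDiff ℝ ∞ T) (hP : ContDiff ℝ ∞ P)
    (hTξ : ∀ x, fderiv ℝ T x (ξ x) = 1) (hTη : ∀ x, fderiv ℝ T x (η x) = 0)
    (hPξ : ∀ x, fderiv ℝ P x (ξ x) = 0) (hPη : ∀ x, fderiv ℝ P x (η x) = 1)
    {p : Fin 4 → ℝ} (hTp : T p = 0) (hPp : P p = 0) :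
    ∃ e : OpenPartialHomeomorph (Fin 4 → ℝ) (Fin 4 → ℝ), p ∈ e.source ∧
      ContDiffOn ℝ ∞ e e.source ∧ ContDiffOn ℝ ∞ e.symm e.target ∧
      (∀ x, e x 0 = T x) ∧ (∀ x, e x 1 = P x) ∧
      ∀ x ∈ e.source, fderiv ℝ e x (ξ x) = Pi.single 0 1 ∧ fderiv ℝ e x (η x) = Pi.single 1 1 := by
  obtain ⟨U, R, hU, hpU, hR, hRξ, hRη, hRp⟩ :=
    hξ.exists_projection_along_pair hη hcomm hT hP hTξ hTη hPξ hPη hTp hPp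
  obtain ⟨M, hM⟩ := exists_linearMap_injOn_ker (α₁ := (fderiv ℝ T p).toLinearMap)
    (α₂ := (fderiv ℝ P p).toLinearMap) (hTξ p) (hTη p) (hPξ p) (hPη p)
  let L : (Fin 4 → ℝ) →L[ℝ] (Fin 2 → ℝ) := LinearMap.toContinuousLinearMap M
  let φ : (Fin 4 → ℝ) → Fin 4 → ℝ := fun x => ![T x, P x, L (R x) 0, L (R x) 1]
  have hφ : ContDiffOn ℝ ∞ φ U := by
    have hLR : ContDiffOn ℝ ∞ (fun x => L (R x)) U := L.contDiff.comp_contDiffOn hR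
    rw [contDiffOn_pi]
    intro i
    fin_cases i
    · exact hT.contDiffOn
    · exact hP.contDiffOn
    · exact contDiffOn_pi.1 hLR 0
    · exact contDiffOn_pi.1 hLR 1
  have hD : ∀ x ∈ U, ∀ v, fderiv ℝ φ x v =
      ![fderiv ℝ T x v, fderiv ℝ P x v, L (fderiv ℝ R x v) 0, L (fderiv ℝ R x v) 1] := by
    intro x hx v
    have hφx : HasFDerivAt φ (fderiv ℝ φ x) x :=
      ((hφ.contDiffAt (hU.mem_nhds hx)).differentiableAt (by simp)).hasFDerivAt
    have hRx : HasFDerivAt (fun x => L (R x)) (L.comp (fderiv ℝ R x)) x :=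
      L.hasFDerivAt.comp x ((hR.contDiffAt (hU.mem_nhds hx)).differentiableAt
        (by simp)).hasFDerivAt
    have hφi := fun i => hasFDerivAt_pi'.1 hφx i
    have hRi := fun i => hasFDerivAt_pi'.1 hRx i
    ext i
    fin_cases i
    · exact DFunLike.congr_fun ((hφi 0).unique (hT.differentiable (by simp) x).hasFDerivAt) v
    · exact DFunLike.congr_fun ((hφi 1).unique (hP.differentiable (by simp) x).hasFDerivAt) v
    · exact DFunLike.congr_fun ((hφi 2).unique (hRi 0)) v
    · exact DFunLike.congr_fun ((hφi 3).unique (hRi 1)) v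
  have hinj : Function.Injective (fderiv ℝ φ p) := by
    rw [injective_iff_map_eq_zero]
    intro v hv
    rw [hD p hpU] at hv
    have h0 : fderiv ℝ T p v = 0 := congrFun hv 0
    have h1 : fderiv ℝ P p v = 0 := congrFun hv 1
    have h2 : L (fderiv ℝ R p v) 0 = 0 := congrFun hv 2
    have h3 : L (fderiv ℝ R p v) 1 = 0 := congrFun hv 3
    have h4 : fderiv ℝ R p v = v := by rw [hRp, h0, h1]; simp
    rw [h4] at h2 h3
    refine hM v h0 h1 ?_
    ext i
    fin_cases i
    · exact h2
    · exact h3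
  let φ' : (Fin 4 → ℝ) ≃L[ℝ] (Fin 4 → ℝ) :=
    (LinearEquiv.ofInjectiveEndo (fderiv ℝ φ p).toLinearMap hinj).toContinuousLinearEquiv
  have hφ' : HasFDerivAt φ (φ' : (Fin 4 → ℝ) →L[ℝ] (Fin 4 → ℝ)) p :=
    ((hφ.contDiffAt (hU.mem_nhds hpU)).differentiableAt (by simp)).hasFDerivAt
  obtain ⟨e, he, hpe, heU, hesymm, -⟩ := hφ.exists_openPartialHomeomorph_contDiffOn_symm hU hpU hφ'
  refine ⟨e, hpe, ?_, hesymm, fun x => ?_, fun x => ?_, fun x hx => ?_⟩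
  · rw [he]; exact hφ.mono heU
  · rw [he]; rfl
  · rw [he]; rfl
  · rw [he, hD x (heU hx), hD x (heU hx), hTξ, hPξ, hTη, hPη, hRξ x (heU hx), hRη x (heU hx)]
    constructor <;> · ext i; fin_cases i <;> simp

end Chart

section Pullback

variable {E F : Type*} [NormedAddCommGroup E] [NormedSpace ℝ E] [NormedAddCommGroup F]
  [NormedSpace ℝ F]

/-- If `ψ` straightens a Killing field to the constant field `w`, then the components of the
pulled back metric are differentiable and do not change in the direction `w`. -/
theorem IsKilling.fderiv_pullback_eq_zero {B : E → E →L[ℝ] E →L[ℝ] ℝ} (hB : Differentiable ℝ B)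
    {f : E → E} (hf : Differentiable ℝ f) (hK : IsKilling B f) {ψ : F → E} {V : Set F}
    (hV : IsOpen V) (hψ : ContDiffOn ℝ ∞ ψ V) {w : F} (hw : ∀ y ∈ V, fderiv ℝ ψ y w = f (ψ y))
    (u v : F) {y : F} (hy : y ∈ V) :
    fderiv ℝ (fun y => B (ψ y) (fderiv ℝ ψ y u) (fderiv ℝ ψ y v)) y w = 0 := by
  have hc : ContDiffAt ℝ ∞ ψ y := hψ.contDiffAt (hV.mem_nhds hy)
  have hs : IsSymmSndFDerivAt ℝ ψ y := hc.isSymmSndFDerivAt (by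
    rw [minSmoothness_of_isRCLikeNormedField]; exact ENat.LEInfty.out)
  have h0 : HasFDerivAt ψ (fderiv ℝ ψ y) y := (hc.differentiableAt (by simp)).hasFDerivAt
  have h1 : HasFDerivAt (fderiv ℝ ψ) (fderiv ℝ (fderiv ℝ ψ) y) y :=
    ((hc.fderiv_right (m := 1) (by norm_cast)).differentiableAt (by simp)).hasFDerivAt
  have hz : ∀ z, HasFDerivAt (fun y => fderiv ℝ ψ y z)
      ((ContinuousLinearMap.apply ℝ E z).comp (fderiv ℝ (fderiv ℝ ψ) y)) y := fun z =>
    (ContinuousLinearMap.apply ℝ E z).hasFDerivAt.comp y h1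
  have hwz : ∀ z, fderiv ℝ (fderiv ℝ ψ) y w z = fderiv ℝ f (ψ y) (fderiv ℝ ψ y z) := by
    intro z
    have h2 : HasFDerivAt (fun y => fderiv ℝ ψ y w) ((fderiv ℝ f (ψ y)).comp (fderiv ℝ ψ y)) y := by
      refine ((hf (ψ y)).hasFDerivAt.comp y h0).congr_of_eventuallyEq ?_
      filter_upwards [hV.mem_nhds hy] with r hr using hw r hr
    rw [hs.eq w z]
    exact DFunLike.congr_fun ((hz w).unique h2) z
  have hBψ : HasFDerivAt (fun y => B (ψ y)) ((fderiv ℝ B (ψ y)).comp (fderiv ℝ ψ y)) y :=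
    HasFDerivAt.comp (g := B) y (hB (ψ y)).hasFDerivAt h0
  rw [((hBψ.clm_apply (hz u)).clm_apply (hz v)).fderiv]
  have h3 := hK (ψ y) (fderiv ℝ ψ y u) (fderiv ℝ ψ y v)
  simp [hwz, hw y hy]
  linarith

theorem Convex.eq_of_fderiv_apply_sub_eq_zero {V : Set F} (hV : IsOpen V) (hVc : Convex ℝ V)
    {h : F → ℝ} (hh : DifferentiableOn ℝ h V) {y z : F} (hy : y ∈ V) (hz : z ∈ V)
    (h0 : ∀ x ∈ V, fderiv ℝ h x (y - z) = 0) : h y = h z := by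
  have hd : ∀ t ∈ Icc (0 : ℝ) 1, HasDerivAt (fun t : ℝ => h (z + t • (y - z))) 0 t := by
    intro t ht
    have hm : z + t • (y - z) ∈ V := hVc.add_smul_sub_mem hz hy ht
    have h1 : HasDerivAt (fun t : ℝ => z + t • (y - z)) (y - z) t := by
      simpa using ((hasDerivAt_id t).smul_const (y - z)).const_add z
    have h2 := ((hh.differentiableAt (hV.mem_nhds hm)).hasFDerivAt).comp_hasDerivAt t h1
    rw [h0 _ hm] at h2
    exact h2
  have := constant_of_has_deriv_right_zero (fun t ht => (hd t ht).continuousAt.continuousWithinAt)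
    (fun t ht => (hd t (Ico_subset_Icc_self ht)).hasDerivWithinAt) 1 (by simp)
  simpa using this

end Pullback

section MatrixForm

theorem fderiv_clm_apply_apply_const {E F G H : Type*} [NormedAddCommGroup E] [NormedSpace ℝ E]
    [NormedAddCommGroup F] [NormedSpace ℝ F] [NormedAddCommGroup G] [NormedSpace ℝ G]
    [NormedAddCommGroup H] [NormedSpace ℝ H] {B : E → F →L[ℝ] G →L[ℝ] H} {x : E}
    (hB : DifferentiableAt ℝ B x) (w : E) (u : F) (v : G) :
    fderiv ℝ (fun y => B y u v) x w = fderiv ℝ B x w u v := by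
  have h1 : HasFDerivAt (fun y => B y u)
      ((ContinuousLinearMap.apply ℝ (G →L[ℝ] H) u).comp (fderiv ℝ B x)) x :=
    HasFDerivAt.comp (f := B) x (ContinuousLinearMap.apply ℝ (G →L[ℝ] H) u).hasFDerivAt
      hB.hasFDerivAt
  have h2 : HasFDerivAt (fun y => B y u v) ((ContinuousLinearMap.apply ℝ H v).comp
      ((ContinuousLinearMap.apply ℝ (G →L[ℝ] H) u).comp (fderiv ℝ B x))) x :=
    (ContinuousLinearMap.apply ℝ H v).hasFDerivAt.comp x h1
  rw [h2.fderiv]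
  rfl

theorem ContDiff.sum_sum_smul_const {E F ι κ : Type*} [NormedAddCommGroup E] [NormedSpace ℝ E]
    [NormedAddCommGroup F] [NormedSpace ℝ F] [Fintype ι] [Fintype κ] {k : ℕ∞ω}
    {a : ι → κ → E → ℝ} (ha : ∀ i j, ContDiff ℝ k (a i j)) (c : ι → κ → F) :
    ContDiff ℝ k fun x => ∑ i, ∑ j, a i j x • c i j :=
  ContDiff.sum fun i _ => ContDiff.sum fun j _ => (ha i j).smul contDiff_const

/-- The field of continuous bilinear forms given by a field of matrices. -/
noncomputable def matrixBilinear {n : Type*} [Fintype n] (g : (n → ℝ) → Matrix n n ℝ)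
    (x : n → ℝ) : (n → ℝ) →L[ℝ] (n → ℝ) →L[ℝ] ℝ :=
  ∑ μ, ∑ ν, g x μ ν • (ContinuousLinearMap.proj μ : (n → ℝ) →L[ℝ] ℝ).smulRight
    (ContinuousLinearMap.proj ν : (n → ℝ) →L[ℝ] ℝ)

variable {n : Type*} [Fintype n] {g : (n → ℝ) → Matrix n n ℝ}

theorem matrixBilinear_apply (x u v : n → ℝ) :
    matrixBilinear g x u v = ∑ μ, ∑ ν, g x μ ν * (u μ * v ν) := by
  simp [matrixBilinear]

theorem matrixBilinear_eq_dotProduct (x u v : n → ℝ) :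
    matrixBilinear g x u v = dotProduct u ((g x).mulVec v) := by
  simp only [matrixBilinear_apply, dotProduct, Matrix.mulVec, Finset.mul_sum]
  refine Finset.sum_congr rfl fun μ _ => Finset.sum_congr rfl fun ν _ => by ring

theorem matrixBilinear_single [DecidableEq n] (x : n → ℝ) (μ ν : n) :
    matrixBilinear g x (Pi.single μ 1) (Pi.single ν 1) = g x μ ν := by
  simp [matrixBilinear_eq_dotProduct]

theorem matrixBilinear_symm (hg : ∀ x, (g x).transpose = g x) (x u v : n → ℝ) :
    matrixBilinear g x u v = matrixBilinear g x v u := by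
  rw [matrixBilinear_apply, matrixBilinear_apply, Finset.sum_comm]
  refine Finset.sum_congr rfl fun μ _ => Finset.sum_congr rfl fun ν _ => ?_
  rw [← hg x, Matrix.transpose_apply, hg x]
  ring

theorem contDiff_matrixBilinear (hg : ∀ μ ν, ContDiff ℝ ∞ fun x => g x μ ν) :
    ContDiff ℝ ∞ (matrixBilinear g) :=
  ContDiff.sum_sum_smul_const hg _

theorem isKilling_matrixBilinear [DecidableEq n] (hg : ∀ μ ν, ContDiff ℝ ∞ fun x => g x μ ν)
    {ξ : (n → ℝ) → n → ℝ}
    (hK : ∀ (x : n → ℝ) (μ ν : n), fderiv ℝ (fun p => g p μ ν) x (ξ x)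
        + ∑ l, (g x l ν * fderiv ℝ ξ x (Pi.single μ 1) l
            + g x μ l * fderiv ℝ ξ x (Pi.single ν 1) l) = 0) :
    IsKilling (matrixBilinear g) ξ := by
  intro x u v
  have h1 : ∀ w l, fderiv ℝ ξ x w l = ∑ μ, w μ * fderiv ℝ ξ x (Pi.single μ 1) l := by
    intro w l
    conv_lhs => rw [pi_eq_sum_univ' w]
    simp [map_sum]
  have h2 : fderiv ℝ (matrixBilinear g) x (ξ x) u v =
      ∑ μ, ∑ ν, fderiv ℝ (fun p => g p μ ν) x (ξ x) * (u μ * v ν) := by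
    have hd : HasFDerivAt (fun y => matrixBilinear g y u v)
        (∑ μ, ∑ ν, (u μ * v ν) • fderiv ℝ (fun p => g p μ ν) x) x := by
      simp only [matrixBilinear_apply]
      exact HasFDerivAt.fun_sum fun μ _ => HasFDerivAt.fun_sum fun ν _ =>
        (((hg μ ν).differentiable (by simp)) x).hasFDerivAt.mul_const _
    rw [← fderiv_clm_apply_apply_const
      ((contDiff_matrixBilinear hg).differentiable (by simp) x), hd.fderiv]
    simp [mul_comm]
  have h3 : matrixBilinear g x (fderiv ℝ ξ x u) v =
      ∑ μ, ∑ ν, (∑ l, g x l ν * fderiv ℝ ξ x (Pi.single μ 1) l) * (u μ * v ν) := by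
    rw [matrixBilinear_apply]
    simp only [h1 u, Finset.sum_mul, Finset.mul_sum]
    refine Finset.sum_comm.trans ?_
    refine (Finset.sum_congr rfl fun ν _ => Finset.sum_comm).trans ?_
    refine Finset.sum_comm.trans ?_
    refine Finset.sum_congr rfl fun μ _ => Finset.sum_congr rfl fun ν _ =>
      Finset.sum_congr rfl fun l _ => by ring
  have h4 : matrixBilinear g x u (fderiv ℝ ξ x v) =
      ∑ μ, ∑ ν, (∑ l, g x μ l * fderiv ℝ ξ x (Pi.single ν 1) l) * (u μ * v ν) := by
    rw [matrixBilinear_apply]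
    simp only [h1 v, Finset.sum_mul, Finset.mul_sum]
    refine Finset.sum_congr rfl fun μ _ => ?_
    rw [Finset.sum_comm]
    refine Finset.sum_congr rfl fun ν _ => Finset.sum_congr rfl fun l _ => by ring
  rw [h2, h3, h4, ← Finset.sum_add_distrib, ← Finset.sum_add_distrib]
  refine Finset.sum_eq_zero fun μ _ => ?_
  rw [← Finset.sum_add_distrib, ← Finset.sum_add_distrib]
  refine Finset.sum_eq_zero fun ν _ => ?_
  have := hK x μ ν
  rw [Finset.sum_add_distrib] at this
  rw [← add_mul, ← add_mul, add_assoc, this, zero_mul]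

end MatrixForm

/-- Coordinates straightening the two Killing fields, in which the components
of the metric do not depend on the first two coordinates and have no cross terms. -/
theorem IsKilling.exists_block_chart
    {B : (Fin 4 → ℝ) → (Fin 4 → ℝ) →L[ℝ] (Fin 4 → ℝ) →L[ℝ] ℝ} (hB : ContDiff ℝ ∞ B)
    (hsymm : ∀ x u v, B x u v = B x v u) {ξ η : (Fin 4 → ℝ) → Fin 4 → ℝ}
    (hξ : ContDiff ℝ ∞ ξ) (hη : ContDiff ℝ ∞ η) (hKξ : IsKilling B ξ) (hKη : IsKilling B η)
    (hcomm : ∀ x, fderiv ℝ η x (ξ x) = fderiv ℝ ξ x (η x))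
    (hnd : ∀ x, B x (ξ x) (ξ x) * B x (η x) (η x) - B x (ξ x) (η x) ^ 2 ≠ 0)
    (hOT : ∀ X Y : (Fin 4 → ℝ) → Fin 4 → ℝ, ContDiff ℝ ∞ X → ContDiff ℝ ∞ Y →
      (∀ x, B x (ξ x) (X x) = 0 ∧ B x (η x) (X x) = 0) →
      (∀ x, B x (ξ x) (Y x) = 0 ∧ B x (η x) (Y x) = 0) → ∀ x,
      B x (ξ x) (fderiv ℝ Y x (X x) - fderiv ℝ X x (Y x)) = 0 ∧
      B x (η x) (fderiv ℝ Y x (X x) - fderiv ℝ X x (Y x)) = 0) (p : Fin 4 → ℝ) :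
    ∃ (s : Set (Fin 4 → ℝ)) (φ : (Fin 4 → ℝ) → Fin 4 → ℝ)
      (E : Fin 4 → (Fin 4 → ℝ) → Fin 4 → ℝ) (h : Fin 4 → Fin 4 → ℝ → ℝ → ℝ),
      IsOpen s ∧ p ∈ s ∧ ContDiffOn ℝ ∞ φ s ∧ InjOn φ s ∧
      (∀ x ∈ s, fderiv ℝ φ x (ξ x) = Pi.single 0 1) ∧
      (∀ x ∈ s, fderiv ℝ φ x (η x) = Pi.single 1 1) ∧
      (∀ x ∈ s, ∀ v, v = ∑ a, fderiv ℝ φ x v a • E a x) ∧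
      (∀ x ∈ s, ∀ a b, B x (E a x) (E b x) = h a b (φ x 2) (φ x 3)) ∧
      ∀ x ∈ s, ∀ a b, (a = 0 ∨ a = 1) → (b = 2 ∨ b = 3) → B x (E a x) (E b x) = 0 := by
  obtain ⟨T, P, hT, hP, hTp, hPp, hTξ, hTη, hPξ, hPη, hW⟩ :=
    hKξ.exists_dual_functions hB hsymm hξ hη hKη hcomm hnd hOT p
  obtain ⟨e, hpe, he, hesymm, heT, heP, heD⟩ :=
    hξ.exists_adapted_chart hη hcomm hT hP hTξ hTη hPξ hPη hTp hPp
  have hde : ∀ x ∈ e.source, HasFDerivAt e (fderiv ℝ e x) x := fun x hx =>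
    ((he.contDiffAt (e.open_source.mem_nhds hx)).differentiableAt (by simp)).hasFDerivAt
  have hds : ∀ y ∈ e.target, HasFDerivAt e.symm (fderiv ℝ e.symm y) y := fun y hy =>
    ((hesymm.contDiffAt (e.open_target.mem_nhds hy)).differentiableAt (by simp)).hasFDerivAt
  have hleft : ∀ x ∈ e.source, ∀ v, fderiv ℝ e.symm (e x) (fderiv ℝ e x v) = v := by
    intro x hx v
    have h1 := (hds (e x) (e.map_source hx)).comp x (hde x hx)
    have h2 : HasFDerivAt (e.symm ∘ e) (ContinuousLinearMap.id ℝ _) x :=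
      (hasFDerivAt_id x).congr_of_eventuallyEq (e.eventually_left_inverse hx)
    exact DFunLike.congr_fun (h1.unique h2) v
  have hright : ∀ x ∈ e.source, ∀ v, fderiv ℝ e x (fderiv ℝ e.symm (e x) v) = v := by
    intro x hx v
    have h1 := HasFDerivAt.comp (g := e) (f := e.symm) (e x)
      (by rw [e.left_inv hx]; exact hde x hx) (hds (e x) (e.map_source hx))
    have h2 : HasFDerivAt (e ∘ e.symm) (ContinuousLinearMap.id ℝ _) (e x) :=
      (hasFDerivAt_id (e x)).congr_of_eventuallyEq
        (e.eventually_right_inverse (e.map_source hx))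
    exact DFunLike.congr_fun (h1.unique h2) v
  obtain ⟨r, hr, hrt⟩ := Metric.isOpen_iff.1 e.open_target (e p) (e.map_source hpe)
  let V := Metric.ball (e p) r
  have hVo : IsOpen V := Metric.isOpen_ball
  have hψ : ContDiffOn ℝ ∞ e.symm V := hesymm.mono hrt
  have hξV : ∀ y ∈ V, fderiv ℝ e.symm y (Pi.single 0 1) = ξ (e.symm y) := by
    intro y hy
    have hm := e.map_target (hrt hy)
    have := hleft _ hm (ξ (e.symm y))
    rwa [(heD _ hm).1, e.right_inv (hrt hy)] at this
  have hηV : ∀ y ∈ V, fderiv ℝ e.symm y (Pi.single 1 1) = η (e.symm y) := by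
    intro y hy
    have hm := e.map_target (hrt hy)
    have := hleft _ hm (η (e.symm y))
    rwa [(heD _ hm).2, e.right_inv (hrt hy)] at this
  let H : Fin 4 → Fin 4 → (Fin 4 → ℝ) → ℝ := fun a b y =>
    B (e.symm y) (fderiv ℝ e.symm y (Pi.single a 1)) (fderiv ℝ e.symm y (Pi.single b 1))
  have hH : ∀ a b, DifferentiableOn ℝ (H a b) V := by
    intro a b
    have h1 : ContDiffOn ℝ 1 (fderiv ℝ e.symm) V :=
      hψ.fderiv_of_isOpen hVo (by norm_cast)
    have h2 : ContDiffOn ℝ 1 (fun y => B (e.symm y)) V :=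
      (hB.comp_contDiffOn hψ).of_le (by norm_cast)
    exact ((h2.clm_apply (h1.clm_apply contDiffOn_const)).clm_apply
      (h1.clm_apply contDiffOn_const)).differentiableOn (by simp)
  have hBd := hB.differentiable (by simp)
  have hH0 : ∀ a b, ∀ y ∈ V, fderiv ℝ (H a b) y (Pi.single 0 1) = 0 := fun a b y hy =>
    hKξ.fderiv_pullback_eq_zero hBd (hξ.differentiable (by simp)) hVo hψ hξV _ _ hy
  have hH1 : ∀ a b, ∀ y ∈ V, fderiv ℝ (H a b) y (Pi.single 1 1) = 0 := fun a b y hy =>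
    hKη.fderiv_pullback_eq_zero hBd (hη.differentiable (by simp)) hVo hψ hηV _ _ hy
  have hHc : ∀ a b, ∀ y ∈ V, H a b y = H a b ![0, 0, y 2, y 3] := by
    intro a b y hy
    have hz : ![0, 0, y 2, y 3] ∈ V := by
      have hy' := (dist_pi_lt_iff hr).1 (Metric.mem_ball.1 hy)
      refine Metric.mem_ball.2 ((dist_pi_lt_iff hr).2 fun i => ?_)
      fin_cases i
      · simpa [heT, hTp] using hr
      · simpa [heP, hPp] using hr
      · exact hy' 2
      · exact hy' 3
    refine (convex_ball (e p) r).eq_of_fderiv_apply_sub_eq_zero hVo (hH a b) hy hz fun x hx => ?_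
    have : y - ![0, 0, y 2, y 3] = y 0 • Pi.single 0 1 + y 1 • Pi.single 1 1 := by
      ext i; fin_cases i <;> simp
    rw [this, map_add, map_smul, map_smul, hH0 a b x hx, hH1 a b x hx]
    simp
  refine ⟨e.source ∩ e ⁻¹' V, e, fun a x => fderiv ℝ e.symm (e x) (Pi.single a 1),
    fun a b c d => H a b ![0, 0, c, d], e.continuousOn.isOpen_inter_preimage e.open_source hVo,
    ⟨hpe, Metric.mem_ball_self hr⟩, he.mono inter_subset_left, e.injOn.mono inter_subset_left,
    fun x hx => (heD x hx.1).1, fun x hx => (heD x hx.1).2, fun x hx v => ?_,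
    fun x hx a b => ?_, fun x hx a b ha hb => ?_⟩
  · conv_lhs => rw [← hleft x hx.1 v, pi_eq_sum_univ' (fderiv ℝ e x v), map_sum]
    simp
  · refine Eq.trans ?_ (hHc a b (e x) hx.2)
    simp only [H, e.left_inv hx.1]
  · have hcoord : ∀ v, fderiv ℝ T x v = fderiv ℝ e x v 0 ∧ fderiv ℝ P x v = fderiv ℝ e x v 1 := by
      intro v
      have h1 := hasFDerivAt_pi'.1 (hde x hx.1)
      have hT' : HasFDerivAt (fun y => e y 0) (fderiv ℝ T x) x := by
        simp only [heT]; exact (hT.differentiable (by simp) x).hasFDerivAt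
      have hP' : HasFDerivAt (fun y => e y 1) (fderiv ℝ P x) x := by
        simp only [heP]; exact (hP.differentiable (by simp) x).hasFDerivAt
      exact ⟨DFunLike.congr_fun (hT'.unique (h1 0)) v, DFunLike.congr_fun (hP'.unique (h1 1)) v⟩
    have hperp := (hW x (fderiv ℝ e.symm (e x) (Pi.single b 1))).1 (by
      rw [(hcoord _).1, (hcoord _).2, hright x hx.1]
      rcases hb with rfl | rfl <;> simp)
    rcases ha with rfl | rfl
    · simp only [hξV (e x) hx.2, e.left_inv hx.1]; exact hperp.1
    · simp only [hηV (e x) hx.2, e.left_inv hx.1]; exact hperp.2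

end LocalGeometry

open Matrix

/-- If `ξ, η` are commuting Killing vector fields of a
(pseudo-Riemannian) metric `g` on `ℝ⁴` spanning a timelike 2-plane at each
point and acting orthogonally transitively (the distribution `g`-orthogonal to
`span{ξ,η}` is involutive), then around any point there exist adapted
coordinates `φ = (T, Φ, x², x³)` with `ξ = ∂_T`, `η = ∂_Φ` in which the metric
takes the 2+2 block-diagonal form
`ds² = G_{ab}(x^M) dy^a dy^b + g_{MN}(x^M) dx^M dx^N`, i.e. with no cross
terms and all components depending only on `x², x³`. -/
theorem stmt_15
    (g : (Fin 4 → ℝ) → Matrix (Fin 4) (Fin 4) ℝ)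
    (hg_smooth : ∀ μ ν, ContDiff ℝ (⊤ : ℕ∞) fun x : Fin 4 → ℝ => g x μ ν)
    (hg_symm : ∀ x, (g x)ᵀ = g x)
    (hg_nondeg : ∀ x, IsUnit (g x).det)
    (ξ η : (Fin 4 → ℝ) → Fin 4 → ℝ)
    (hξ_smooth : ContDiff ℝ (⊤ : ℕ∞) ξ) (hη_smooth : ContDiff ℝ (⊤ : ℕ∞) η)
    (hKillξ : ∀ (x : Fin 4 → ℝ) (μ ν : Fin 4),
      fderiv ℝ (fun p => g p μ ν) x (ξ x)
        + ∑ l : Fin 4, (g x l ν * fderiv ℝ ξ x (Pi.single μ 1) l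
            + g x μ l * fderiv ℝ ξ x (Pi.single ν 1) l) = 0)
    (hKillη : ∀ (x : Fin 4 → ℝ) (μ ν : Fin 4),
      fderiv ℝ (fun p => g p μ ν) x (η x)
        + ∑ l : Fin 4, (g x l ν * fderiv ℝ η x (Pi.single μ 1) l
            + g x μ l * fderiv ℝ η x (Pi.single ν 1) l) = 0)
    (hcomm : ∀ x, fderiv ℝ η x (ξ x) - fderiv ℝ ξ x (η x) = 0)
    (hindep : ∀ x, LinearIndependent ℝ ![ξ x, η x])
    (htimelike : ∀ x,
      (ξ x ⬝ᵥ (g x).mulVec (ξ x)) * (η x ⬝ᵥ (g x).mulVec (η x))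
        - (ξ x ⬝ᵥ (g x).mulVec (η x)) ^ 2 < 0)
    (hOT : ∀ X Y : (Fin 4 → ℝ) → Fin 4 → ℝ, ContDiff ℝ (⊤ : ℕ∞) X → ContDiff ℝ (⊤ : ℕ∞) Y →
      (∀ x, X x ⬝ᵥ (g x).mulVec (ξ x) = 0 ∧ X x ⬝ᵥ (g x).mulVec (η x) = 0) →
      (∀ x, Y x ⬝ᵥ (g x).mulVec (ξ x) = 0 ∧ Y x ⬝ᵥ (g x).mulVec (η x) = 0) →
      ∀ x, (fderiv ℝ Y x (X x) - fderiv ℝ X x (Y x)) ⬝ᵥ (g x).mulVec (ξ x) = 0 ∧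
           (fderiv ℝ Y x (X x) - fderiv ℝ X x (Y x)) ⬝ᵥ (g x).mulVec (η x) = 0)
    (p : Fin 4 → ℝ) :
    ∃ (s : Set (Fin 4 → ℝ)) (φ : (Fin 4 → ℝ) → Fin 4 → ℝ)
      (Gb gb : ℝ → ℝ → Matrix (Fin 2) (Fin 2) ℝ),
      IsOpen s ∧ p ∈ s ∧ ContDiffOn ℝ (⊤ : ℕ∞) φ s ∧ Set.InjOn φ s ∧
      (∀ x ∈ s, IsUnit (Matrix.of fun a μ : Fin 4 => fderiv ℝ φ x (Pi.single μ 1) a).det) ∧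
      (∀ x ∈ s, fderiv ℝ φ x (ξ x) = Pi.single 0 1) ∧
      (∀ x ∈ s, fderiv ℝ φ x (η x) = Pi.single 1 1) ∧
      (∀ x ∈ s,
        g x = (Matrix.of fun a μ : Fin 4 => fderiv ℝ φ x (Pi.single μ 1) a)ᵀ *
          !![Gb (φ x 2) (φ x 3) 0 0, Gb (φ x 2) (φ x 3) 0 1, 0, 0;
             Gb (φ x 2) (φ x 3) 1 0, Gb (φ x 2) (φ x 3) 1 1, 0, 0;
             0, 0, gb (φ x 2) (φ x 3) 0 0, gb (φ x 2) (φ x 3) 0 1;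
             0, 0, gb (φ x 2) (φ x 3) 1 0, gb (φ x 2) (φ x 3) 1 1] *
          (Matrix.of fun a μ : Fin 4 => fderiv ℝ φ x (Pi.single μ 1) a)) := by
  have hsymm := matrixBilinear_symm hg_symm
  have hdot : ∀ x u v, u ⬝ᵥ (g x).mulVec v = matrixBilinear g x v u := fun x u v => by
    rw [hsymm, matrixBilinear_eq_dotProduct]
  simp only [hdot] at htimelike hOT
  obtain ⟨s, φ, E, h, hs, hps, hφ, hinj, hφξ, hφη, hdec, hh, hcross⟩ :=
    (isKilling_matrixBilinear hg_smooth hKillξ).exists_block_chart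
      (contDiff_matrixBilinear hg_smooth) hsymm hξ_smooth hη_smooth
      (isKilling_matrixBilinear hg_smooth hKillη) (fun x => sub_eq_zero.1 (hcomm x))
      (fun x => by rw [hsymm x (ξ x) (η x)]; exact (htimelike x).ne) hOT p
  let Gb : ℝ → ℝ → Matrix (Fin 2) (Fin 2) ℝ := fun c d =>
    !![h 0 0 c d, h 0 1 c d; h 1 0 c d, h 1 1 c d]
  let gb : ℝ → ℝ → Matrix (Fin 2) (Fin 2) ℝ := fun c d =>
    !![h 2 2 c d, h 2 3 c d; h 3 2 c d, h 3 3 c d]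
  have hmetric : ∀ x ∈ s,
      g x = (Matrix.of fun a μ : Fin 4 => fderiv ℝ φ x (Pi.single μ 1) a)ᵀ *
        !![Gb (φ x 2) (φ x 3) 0 0, Gb (φ x 2) (φ x 3) 0 1, 0, 0;
           Gb (φ x 2) (φ x 3) 1 0, Gb (φ x 2) (φ x 3) 1 1, 0, 0;
           0, 0, gb (φ x 2) (φ x 3) 0 0, gb (φ x 2) (φ x 3) 0 1;
           0, 0, gb (φ x 2) (φ x 3) 1 0, gb (φ x 2) (φ x 3) 1 1] *
        (Matrix.of fun a μ : Fin 4 => fderiv ℝ φ x (Pi.single μ 1) a) := by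
    intro x hx
    have hblock : !![Gb (φ x 2) (φ x 3) 0 0, Gb (φ x 2) (φ x 3) 0 1, 0, 0;
           Gb (φ x 2) (φ x 3) 1 0, Gb (φ x 2) (φ x 3) 1 1, 0, 0;
           0, 0, gb (φ x 2) (φ x 3) 0 0, gb (φ x 2) (φ x 3) 0 1;
           0, 0, gb (φ x 2) (φ x 3) 1 0, gb (φ x 2) (φ x 3) 1 1] =
        Matrix.of fun a b => matrixBilinear g x (E a x) (E b x) := by
      have h0 : ∀ a b, (a = 0 ∨ a = 1) → (b = 2 ∨ b = 3) → h a b (φ x 2) (φ x 3) = 0 :=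
        fun a b ha hb => by rw [← hh x hx, hcross x hx a b ha hb]
      have h1 : ∀ a b, (a = 2 ∨ a = 3) → (b = 0 ∨ b = 1) → h a b (φ x 2) (φ x 3) = 0 :=
        fun a b ha hb => by rw [← hh x hx, hsymm, hcross x hx b a hb ha]
      ext a b
      fin_cases a <;> fin_cases b <;>
        simp [Gb, gb, hh x hx, h0 0 2, h0 0 3, h0 1 2, h0 1 3, h1 2 0, h1 2 1, h1 3 0, h1 3 1]
    rw [hblock]
    ext μ ν
    rw [← matrixBilinear_single (g := g) x μ ν]
    conv_lhs => rw [hdec x hx (Pi.single μ 1), hdec x hx (Pi.single ν 1)]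
    simp only [Matrix.mul_apply, Matrix.transpose_apply, Matrix.of_apply, map_sum, map_smul,
      _root_.sum_apply, _root_.smul_apply, smul_eq_mul, Finset.sum_mul, Finset.mul_sum]
    refine Finset.sum_congr rfl fun b _ => Finset.sum_congr rfl fun a _ => by ring
  refine ⟨s, φ, Gb, gb, hs, hps, hφ, hinj, fun x hx => ?_, hφξ, hφη, hmetric⟩
  have := hg_nondeg x
  rw [hmetric x hx, Matrix.det_mul] at this
  exact (IsUnit.mul_iff.1 this).2
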